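/- For every m ∈ ℕ there exists a constant C_m > 0 such that for every integer n ≥ 2 and every x ∈ ℝ, ∫_{[−π,π]^m} L_n(x − y_1) L_n(y_1 − y_2) ⋯ L_n(y_{m−1} − y_m) L_n(y_m) dy_1 ⋯ dy_m ≤ C_m · L_n(x) · (log n)^m. -/

import Mathlib

open MeasureTheory Real Filter Asymptotics Set Finset Topology

noncomputable section

/-- `Π₀ = [-π,π] \ {0}`. -/
def Pi0 : Set ℝ := Set.Icc (-Real.pi) Real.pi \ {0}

/-- Membership in `F_α`: integrable on `Π` with `sup_{x ∈ Π₀} |x|^α |f(x)| < ∞`. -/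
def MemF (a : ℝ) (f : ℝ → ℝ) : Prop :=
  MeasureTheory.IntegrableOn f (Set.Icc (-Real.pi) Real.pi) ∧
    ∃ M : ℝ, ∀ x ∈ Pi0, |x| ^ a * |f x| ≤ M

/-- Membership in `F_α^{(1)}`: in `F_α`, continuously differentiable on `Π₀`,
with `sup_{x ∈ Π₀} |x|^{α+1} |f'(x)| < ∞`. -/
def MemF1 (a : ℝ) (f : ℝ → ℝ) : Prop :=
  MemF a f ∧
    ∃ f' : ℝ → ℝ, ContinuousOn f' Pi0 ∧
      (∀ x ∈ Pi0, HasDerivWithinAt f (f' x) Pi0 x) ∧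
      ∃ M : ℝ, ∀ x ∈ Pi0, |x| ^ (a + 1) * |f' x| ≤ M

/-- `τ`-th Fourier coefficient `∫_Π e^{iτx} f(x) dx`. -/
def fourierCoef (f : ℝ → ℝ) (τ : ℤ) : ℂ :=
  ∫ x in Set.Icc (-Real.pi) Real.pi, Complex.exp (Complex.I * (τ : ℂ) * (x : ℂ)) * (f x : ℂ)

/-- `n × n` Toeplitz matrix with `(i,j)` entry `f̂(i - j)`. -/
def Toep (n : ℕ) (f : ℝ → ℝ) : Matrix (Fin n) (Fin n) ℂ :=
  Matrix.of fun i j : Fin n => fourierCoef f ((i : ℤ) - (j : ℤ))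

/-- `D_n(x) = ∑_{t=1}^n e^{itx}`. -/
def Dn (n : ℕ) (x : ℝ) : ℂ :=
  ∑ t ∈ Finset.range n, Complex.exp (Complex.I * ((t : ℂ) + 1) * (x : ℂ))

/-- `L_n(x) = min(|x|⁻¹, n)` for `x ≠ 0`, and `L_n(0) = n`. -/
def Ln (n : ℕ) (x : ℝ) : ℝ := if x = 0 then (n : ℝ) else min |x|⁻¹ (n : ℝ)

/-- partial sum `x̄_j = x_1 + ⋯ + x_j` (with `x` indexed from `0`). -/
def psum {m : ℕ} (x : Fin m → ℝ) (j : ℕ) : ℝ :=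
  ∑ k ∈ Finset.range j, if h : k < m then x ⟨k, h⟩ else 0

/-- the coordinate `x_{j+1}` (zero-based index `j`), defaulting to `0` out of range. -/
def xval {m : ℕ} (x : Fin m → ℝ) (j : ℕ) : ℝ := if h : j < m then x ⟨j, h⟩ else 0

/-- the cube `Π^m = [-π,π]^m`. -/
def PiBox (m : ℕ) : Set (Fin m → ℝ) := Set.pi Set.univ fun _ => Set.Icc (-Real.pi) Real.pi

/-- `W_i` (here `i : Fin (2p)` encodes the 1-based index `i+1 ∈ {1,…,2p}`):
for `i+1 < 2p`, `W_{i+1} = {x : |x̄_{i+1}| ≤ c |x_{i+2}|}`;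
the last one is `W_{2p} = {x : |x̄_{2p}| ≤ c |x̄_{2p} - x_1|}`. -/
def Wset (p : ℕ) (c : ℝ) (i : Fin (2 * p)) : Set (Fin (2 * p) → ℝ) :=
  if (i : ℕ) + 1 < 2 * p then {x | |psum x ((i : ℕ) + 1)| ≤ c * |xval x ((i : ℕ) + 1)|}
  else {x | |psum x (2 * p)| ≤ c * |psum x (2 * p) - psum x 1|}

/-- `W = ∪_{j=1}^{2p} W_j`. -/
def W (p : ℕ) (c : ℝ) : Set (Fin (2 * p) → ℝ) := ⋃ i, Wset p c i

/-- `k_j^{(π_j)}(x̄_{2j-1})`: equals `g_j(x̄_{2j-1}) h_j(x̄_{2j-1})` when `π_j = 0`, and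
`g_j(x̄_{2j-1}) (h_j(x̄_{2j-1} + x_{2j}) - h_j(x̄_{2j-1}))` when `π_j = 1`. -/
def kfun {p : ℕ} (g h : Fin p → ℝ → ℝ) (sgn : Fin p → Fin 2) (x : Fin (2 * p) → ℝ)
    (j : Fin p) : ℝ :=
  if sgn j = 0 then g j (psum x (2 * (j : ℕ) + 1)) * h j (psum x (2 * (j : ℕ) + 1))
  else
    g j (psum x (2 * (j : ℕ) + 1)) *
      (h j (psum x (2 * (j : ℕ) + 1) + xval x (2 * (j : ℕ) + 1)) -
        h j (psum x (2 * (j : ℕ) + 1)))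

/-- `conj(D_n(x̄_{2p} - x_1)) ∏_{j=2}^{2p} D_n(x_j)`. -/
def Dprod (p n : ℕ) (x : Fin (2 * p) → ℝ) : ℂ :=
  (starRingEnd ℂ) (Dn n (psum x (2 * p) - psum x 1)) *
    ∏ j ∈ Finset.univ.filter fun j : Fin (2 * p) => 1 ≤ (j : ℕ), Dn n (x j)

/-- `I_{n,1}^π`. -/
def I1 {p : ℕ} (g h : Fin p → ℝ → ℝ) (sgn : Fin p → Fin 2) (c : ℝ) (n : ℕ) : ℂ :=
  ∫ x in PiBox (2 * p) ∩ W p c, (↑(∏ j, kfun g h sgn x j) : ℂ) * Dprod p n x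

/-- `I_{n,2}^π`. -/
def I2 {p : ℕ} (g h : Fin p → ℝ → ℝ) (sgn : Fin p → Fin 2) (c : ℝ) (n : ℕ) : ℂ :=
  ∫ x in PiBox (2 * p) ∩ (W p c)ᶜ, (↑(∏ j, kfun g h sgn x j) : ℂ) * Dprod p n x

/-- `I_n`. -/
def Ifull {p : ℕ} (g h : Fin p → ℝ → ℝ) (n : ℕ) : ℂ :=
  ∫ x in PiBox (2 * p),
    (↑(∏ j : Fin p, g j (psum x (2 * (j : ℕ) + 1)) * h j (psum x (2 * (j : ℕ) + 1))) : ℂ) *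
      Dprod p n x

lemma Ln_nonneg (n : ℕ) (x : ℝ) : 0 ≤ Ln n x := by
  unfold Ln; split_ifs <;> positivity

lemma Ln_le_n (n : ℕ) (x : ℝ) : Ln n x ≤ n := by
  unfold Ln; split_ifs
  · exact le_rfl
  · exact min_le_right _ _

lemma Ln_le_inv (n : ℕ) {x : ℝ} (hx : x ≠ 0) : Ln n x ≤ |x|⁻¹ := by
  unfold Ln; rw [if_neg hx]; exact min_le_left _ _

lemma Ln_measurable (n : ℕ) : Measurable (Ln n) := by
  unfold Ln
  refine Measurable.ite (measurableSet_singleton 0) measurable_const ?_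
  fun_prop

/-- if `|x| ≤ 2|y|` then `L(y) ≤ 2 L(x)`. -/
lemma Ln_le_two (n : ℕ) {x y : ℝ} (h : |x| ≤ 2 * |y|) : Ln n y ≤ 2 * Ln n x := by
  have hn : (0 : ℝ) ≤ n := Nat.cast_nonneg n
  by_cases hx : x = 0
  · have := Ln_le_n n y
    have h2 : Ln n x = n := by simp [Ln, hx]
    rw [h2]; linarith
  · have hx' : 0 < |x| := abs_pos.mpr hx
    have hy' : 0 < |y| := by linarith
    have hy : y ≠ 0 := abs_pos.mp hy'
    have h2 : Ln n x = min |x|⁻¹ n := by simp [Ln, hx]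
    rw [h2, mul_min_of_nonneg _ _ (by norm_num)]
    refine le_min ?_ ?_
    · refine (Ln_le_inv n hy).trans ?_
      rw [inv_eq_one_div, inv_eq_one_div, mul_one_div, div_le_div_iff₀ hy' hx']
      linarith
    · have := Ln_le_n n y
      linarith

lemma Ln_mul_le (n : ℕ) (x y : ℝ) :
    Ln n (x - y) * Ln n y ≤ 2 * Ln n x * (Ln n (x - y) + Ln n y) := by
  have h1 := Ln_nonneg n (x - y)
  have h2 := Ln_nonneg n y
  have h3 := Ln_nonneg n x
  have htri : |x| ≤ |x - y| + |y| := by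
    have := abs_add_le (x - y) y
    simpa using this
  rcases le_total |x - y| |y| with h | h
  · have := Ln_le_two n (x := x) (y := y) (by linarith)
    nlinarith [mul_nonneg h3 h2, mul_le_mul_of_nonneg_left this h1]
  · have := Ln_le_two n (x := x) (y := x - y) (by linarith)
    nlinarith [mul_nonneg h3 h1, mul_le_mul_of_nonneg_right this h2]

lemma lint_inv {a b : ℝ} (hab : a ≤ b) (h0 : (0:ℝ) ∉ Set.uIcc a b) (c : ℝ)
    (hc : ∀ t ∈ Set.Icc a b, 0 ≤ c * t⁻¹) :
    ∫⁻ t in Set.Icc a b, ENNReal.ofReal (c * t⁻¹) = ENNReal.ofReal (c * Real.log (b / a)) := by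
  have hcont : ContinuousOn (fun t : ℝ => c * t⁻¹) (Set.Icc a b) := by
    refine continuousOn_const.mul (continuousOn_id.inv₀ ?_)
    intro t ht h
    apply h0
    rw [Set.uIcc_of_le hab]
    simp only [id] at h
    rwa [h] at ht
  rw [← ofReal_integral_eq_lintegral_ofReal hcont.integrableOn_Icc]
  · rw [MeasureTheory.integral_Icc_eq_integral_Ioc, ← intervalIntegral.integral_of_le hab,
      intervalIntegral.integral_const_mul, integral_inv h0]
  · exact (ae_restrict_iff' measurableSet_Icc).2 (Eventually.of_forall hc)

lemma lint_unit (n : ℕ) (hn : 2 ≤ n) :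
    ∫⁻ t in Set.Icc (-1:ℝ) 1, ENNReal.ofReal (Ln n t) ≤ ENNReal.ofReal (2 + 2 * Real.log n) := by
  have hn' : (2:ℝ) ≤ n := by exact_mod_cast hn
  have hn0 : (0:ℝ) < n := by linarith
  have hlog : 0 ≤ Real.log n := Real.log_nonneg (by linarith)
  have hi : (0:ℝ) < (n:ℝ)⁻¹ := inv_pos.mpr hn0
  have hi1 : (n:ℝ)⁻¹ ≤ 1 := inv_le_one_of_one_le₀ (by linarith)
  have hsub : Set.Icc (-1:ℝ) 1 ⊆ (Set.Icc (-1:ℝ) (-(n:ℝ)⁻¹) ∪ Set.Icc (-(n:ℝ)⁻¹) (n:ℝ)⁻¹)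
      ∪ Set.Icc (n:ℝ)⁻¹ 1 := by
    intro t ht
    simp only [Set.mem_union, Set.mem_Icc] at ht ⊢
    rcases le_total t (-(n:ℝ)⁻¹) with h | h
    · exact Or.inl (Or.inl ⟨ht.1, h⟩)
    · rcases le_total t (n:ℝ)⁻¹ with h' | h'
      · exact Or.inl (Or.inr ⟨h, h'⟩)
      · exact Or.inr ⟨h', ht.2⟩
  have hA : ∫⁻ t in Set.Icc (-1:ℝ) (-(n:ℝ)⁻¹), ENNReal.ofReal (Ln n t) ≤
      ENNReal.ofReal (Real.log n) := by
    calc _ ≤ ∫⁻ t in Set.Icc (-1:ℝ) (-(n:ℝ)⁻¹), ENNReal.ofReal ((-1) * t⁻¹) := by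
          refine setLIntegral_mono' measurableSet_Icc fun t ht => ENNReal.ofReal_le_ofReal ?_
          have htn : t < 0 := by linarith [ht.2]
          refine (Ln_le_inv n htn.ne).trans ?_
          rw [abs_of_neg htn, inv_neg]; linarith
      _ = _ := by
          rw [lint_inv (by linarith)]
          · congr 1
            rw [neg_div_neg_eq, div_one, Real.log_inv]; ring
          · rw [Set.uIcc_of_le (by linarith)]
            intro h
            linarith [h.2]
          · intro t ht
            have htn : t < 0 := by linarith [ht.2]
            have := inv_lt_zero.mpr htn
            linarith
  have hC : ∫⁻ t in Set.Icc (n:ℝ)⁻¹ 1, ENNReal.ofReal (Ln n t) ≤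
      ENNReal.ofReal (Real.log n) := by
    calc _ ≤ ∫⁻ t in Set.Icc (n:ℝ)⁻¹ 1, ENNReal.ofReal (1 * t⁻¹) := by
          refine setLIntegral_mono' measurableSet_Icc fun t ht => ENNReal.ofReal_le_ofReal ?_
          have htn : 0 < t := by linarith [ht.1]
          refine (Ln_le_inv n htn.ne').trans ?_
          rw [abs_of_pos htn]; linarith
      _ = _ := by
          rw [lint_inv hi1]
          · congr 1
            rw [one_div, inv_inv, one_mul]
          · rw [Set.uIcc_of_le hi1]
            intro h
            linarith [h.1]
          · intro t ht
            have htn : 0 < t := by linarith [ht.1]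
            positivity
  have hB : ∫⁻ t in Set.Icc (-(n:ℝ)⁻¹) (n:ℝ)⁻¹, ENNReal.ofReal (Ln n t) ≤ ENNReal.ofReal 2 := by
    calc _ ≤ ∫⁻ t in Set.Icc (-(n:ℝ)⁻¹) (n:ℝ)⁻¹, ENNReal.ofReal n :=
          lintegral_mono fun t => ENNReal.ofReal_le_ofReal (Ln_le_n n t)
      _ = _ := by
          rw [setLIntegral_const, Real.volume_Icc, ← ENNReal.ofReal_mul hn0.le]
          congr 1
          field_simp
          norm_num
  calc _ ≤ _ := lintegral_mono_set hsub
    _ ≤ _ := lintegral_union_le _ _ _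
    _ ≤ _ := add_le_add (lintegral_union_le _ _ _) le_rfl
    _ ≤ _ := add_le_add (add_le_add hA hB) hC
    _ = _ := by
      rw [← ENNReal.ofReal_add hlog (by norm_num), ← ENNReal.ofReal_add (by linarith) hlog]
      congr 1; ring

lemma lint_shift (n : ℕ) (hn : 2 ≤ n) (x : ℝ) :
    ∫⁻ y in Set.Icc (-Real.pi) Real.pi, ENNReal.ofReal (Ln n (x - y)) ≤
      ENNReal.ofReal (22 * Real.log n) := by
  have hn' : (2:ℝ) ≤ n := by exact_mod_cast hn
  have hlog : 1/2 ≤ Real.log n := by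
    have h1 := Real.log_two_gt_d9
    have h2 := Real.log_le_log (by norm_num) hn'
    linarith
  set G : ℝ → ENNReal := (Set.Icc (-1:ℝ) 1).indicator (fun t => ENNReal.ofReal (Ln n t)) with hG
  have hpt : ∀ t, ENNReal.ofReal (Ln n t) ≤ ENNReal.ofReal 1 + G t := by
    intro t
    by_cases ht : t ∈ Set.Icc (-1:ℝ) 1
    · rw [hG, Set.indicator_of_mem ht]; exact le_add_self
    · refine le_trans (ENNReal.ofReal_le_ofReal ?_) le_self_add
      have h1 : 1 < |t| := by
        by_contra h
        exact ht (abs_le.mp (not_lt.mp h))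
      refine (Ln_le_inv n (abs_pos.mp (by linarith))).trans (inv_le_one_of_one_le₀ h1.le)
  calc _ ≤ ∫⁻ y in Set.Icc (-Real.pi) Real.pi, (ENNReal.ofReal 1 + G (x - y)) :=
        lintegral_mono fun y => hpt _
    _ = ENNReal.ofReal (2 * Real.pi) + ∫⁻ y in Set.Icc (-Real.pi) Real.pi, G (x - y) := by
        rw [lintegral_add_left measurable_const, setLIntegral_const, Real.volume_Icc,
          ← ENNReal.ofReal_mul (by norm_num)]
        congr 2; ring
    _ ≤ ENNReal.ofReal (2 * Real.pi) + ∫⁻ y, G (x - y) := by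
        gcongr; exact Measure.restrict_le_self
    _ = ENNReal.ofReal (2 * Real.pi) + ∫⁻ y, G y := by
        rw [lintegral_sub_left_eq_self]
    _ ≤ ENNReal.ofReal (2 * Real.pi) + ENNReal.ofReal (2 + 2 * Real.log n) := by
        gcongr
        rw [hG, lintegral_indicator measurableSet_Icc]
        exact lint_unit n hn
    _ ≤ _ := by
        rw [← ENNReal.ofReal_add (by positivity) (by linarith)]
        apply ENNReal.ofReal_le_ofReal
        linarith [Real.pi_lt_four]

lemma Ln_neg (n : ℕ) (x : ℝ) : Ln n (-x) = Ln n x := by simp [Ln]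

lemma lint_step (n : ℕ) (hn : 2 ≤ n) (x : ℝ) :
    ∫⁻ y in Set.Icc (-Real.pi) Real.pi, ENNReal.ofReal (Ln n (x - y) * Ln n y) ≤
      ENNReal.ofReal (88 * Ln n x * Real.log n) := by
  have hlog : 0 ≤ Real.log n := Real.log_natCast_nonneg n
  have hx := Ln_nonneg n x
  have h0 := lint_shift n hn 0
  simp only [zero_sub, Ln_neg] at h0
  have hm := Ln_measurable n
  calc _ ≤ ∫⁻ y in Set.Icc (-Real.pi) Real.pi, ENNReal.ofReal (2 * Ln n x) *
            (ENNReal.ofReal (Ln n (x - y)) + ENNReal.ofReal (Ln n y)) := by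
        refine lintegral_mono fun y => ?_
        rw [← ENNReal.ofReal_add (Ln_nonneg _ _) (Ln_nonneg _ _),
          ← ENNReal.ofReal_mul (by positivity)]
        exact ENNReal.ofReal_le_ofReal (Ln_mul_le n x y)
    _ = ENNReal.ofReal (2 * Ln n x) *
          ((∫⁻ y in Set.Icc (-Real.pi) Real.pi, ENNReal.ofReal (Ln n (x - y))) +
            ∫⁻ y in Set.Icc (-Real.pi) Real.pi, ENNReal.ofReal (Ln n y)) := by
        rw [lintegral_const_mul _ (by fun_prop), lintegral_add_left (by fun_prop)]
    _ ≤ ENNReal.ofReal (2 * Ln n x) *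
          (ENNReal.ofReal (22 * Real.log n) + ENNReal.ofReal (22 * Real.log n)) := by
        gcongr
        exact lint_shift n hn x
    _ = _ := by
        rw [← ENNReal.ofReal_add (by positivity) (by positivity),
          ← ENNReal.ofReal_mul (by positivity)]
        congr 1; ring

lemma xval_measurable {m : ℕ} (k : ℕ) : Measurable (fun y : Fin m → ℝ => xval y k) := by
  unfold xval
  split_ifs <;> fun_prop

/-- the integrand -/
def prodL (n m : ℕ) (x : ℝ) (y : Fin m → ℝ) : ℝ :=
  ∏ k ∈ Finset.range (m + 1), Ln n ((if k = 0 then x else xval y (k - 1)) - xval y k)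

lemma prodL_nonneg (n m : ℕ) (x : ℝ) (y : Fin m → ℝ) : 0 ≤ prodL n m x y :=
  Finset.prod_nonneg fun _ _ => Ln_nonneg _ _

lemma prodL_measurable (n m : ℕ) :
    Measurable (fun p : ℝ × (Fin m → ℝ) => prodL n m p.1 p.2) := by
  unfold prodL
  refine Finset.measurable_prod _ fun k _ => (Ln_measurable n).comp ?_
  refine Measurable.sub ?_ ((xval_measurable k).comp measurable_snd)
  split_ifs
  · exact measurable_fst
  · exact (xval_measurable (k-1)).comp measurable_snd

lemma prodL_cons (n m : ℕ) (x y0 : ℝ) (y : Fin m → ℝ) :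
    prodL n (m + 1) x (Fin.cons y0 y) = Ln n (x - y0) * prodL n m y0 y := by
  have hs : ∀ k, xval (Fin.cons y0 y : Fin (m+1) → ℝ) (k + 1) = xval y k := by
    intro k
    unfold xval
    by_cases h : k < m
    · rw [dif_pos h, dif_pos (by omega)]
      exact Fin.cons_succ (α := fun _ => ℝ) y0 y ⟨k, h⟩
    · rw [dif_neg h, dif_neg (by omega)]
  have h0 : xval (Fin.cons y0 y : Fin (m+1) → ℝ) 0 = y0 := by simp [xval]
  unfold prodL
  rw [Finset.prod_range_succ', mul_comm]
  congr 1
  · refine Finset.prod_congr rfl fun k _ => ?_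
    rcases k with _ | k
    · simp [h0, hs]
    · simp [hs]

/-- Lebesgue measure on the interval -/
abbrev muI : Measure ℝ := volume.restrict (Set.Icc (-Real.pi) Real.pi)

lemma restrict_PiBox (m : ℕ) :
    (volume : Measure (Fin m → ℝ)).restrict (PiBox m) = Measure.pi fun _ => muI := by
  unfold PiBox muI
  rw [volume_pi, Measure.restrict_pi_pi]

lemma lint_main (n : ℕ) (hn : 2 ≤ n) (m : ℕ) : ∀ x : ℝ,
    ∫⁻ y, ENNReal.ofReal (prodL n m x y) ∂(Measure.pi fun _ : Fin m => muI) ≤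
      ENNReal.ofReal (88 ^ m * Ln n x * Real.log n ^ m) := by
  have hlog : 0 ≤ Real.log n := Real.log_natCast_nonneg n
  induction m with
  | zero =>
    intro x
    rw [Measure.pi_of_empty, lintegral_dirac]
    simp [prodL, xval]
  | succ m ih =>
    intro x
    have hmp := (measurePreserving_piFinSuccAbove (fun _ : Fin (m+1) => muI) 0).symm
    rw [← hmp.lintegral_comp_emb (MeasurableEquiv.measurableEmbedding _)]
    have hcons : ∀ p : ℝ × (Fin m → ℝ),
        (MeasurableEquiv.piFinSuccAbove (fun _ : Fin (m+1) => ℝ) 0).symm p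
          = Fin.cons p.1 p.2 := fun p => by
      simp [MeasurableEquiv.piFinSuccAbove, Fin.insertNthEquiv]
    simp only [hcons, prodL_cons]
    have hm := Ln_measurable n
    have hp := prodL_measurable n m
    rw [lintegral_prod _ (by fun_prop)]
    calc _ ≤ ∫⁻ y0, ENNReal.ofReal (88 ^ m * Real.log n ^ m) *
              ENNReal.ofReal (Ln n (x - y0) * Ln n y0) ∂muI := by
          refine lintegral_mono fun y0 => ?_
          simp only [ENNReal.ofReal_mul (Ln_nonneg n (x - y0))]
          rw [lintegral_const_mul _ (by fun_prop)]
          refine (mul_le_mul_right (ih y0) _).trans (le_of_eq ?_)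
          rw [← ENNReal.ofReal_mul (Ln_nonneg _ _), ← ENNReal.ofReal_mul (Ln_nonneg _ _),
            ← ENNReal.ofReal_mul (by positivity)]
          congr 1; ring
      _ ≤ ENNReal.ofReal (88 ^ m * Real.log n ^ m) *
            ENNReal.ofReal (88 * Ln n x * Real.log n) := by
          rw [lintegral_const_mul _ (by fun_prop)]
          gcongr
          exact lint_step n hn x
      _ = _ := by
          rw [← ENNReal.ofReal_mul (by positivity)]
          congr 1; ring

/-- iterated convolution bound
`∫_{Π^m} L_n(x - y_1) L_n(y_1 - y_2) ⋯ L_n(y_{m-1} - y_m) L_n(y_m) dy ≤ C L_n(x) (log n)^m`.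
(Here `y` is zero-based, `xval y m = 0`, so the `k`-th factor of the product is
`L_n(y_k - y_{k+1})` with the conventions `y_0 = x` and `y_{m+1} = 0`.) -/
theorem stmt15 (m : ℕ) :
    ∃ C : ℝ, 0 < C ∧ ∀ n : ℕ, 2 ≤ n → ∀ x : ℝ,
      (∫ y in PiBox m,
          ∏ k ∈ Finset.range (m + 1),
            Ln n ((if k = 0 then x else xval y (k - 1)) - xval y k))
        ≤ C * Ln n x * Real.log n ^ m := by
  refine ⟨88 ^ m, by positivity, fun n hn x => ?_⟩
  have hlog : 0 ≤ Real.log n := Real.log_natCast_nonneg n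
  have hx := Ln_nonneg n x
  change (∫ y in PiBox m, prodL n m x y) ≤ _
  have hp : Measurable (fun y : Fin m → ℝ => prodL n m x y) :=
    (prodL_measurable n m).comp measurable_prodMk_left
  rw [integral_eq_lintegral_of_nonneg_ae (Eventually.of_forall fun y => prodL_nonneg n m x y)
    hp.aestronglyMeasurable, restrict_PiBox]
  exact ENNReal.toReal_le_of_le_ofReal (by positivity) (lint_main n hn m x)
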